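/- Let A be a Bernstein algebra over a field K of characteristic ≠ 2, 3 which is Noetherian or Artinian, with Peirce decomposition A = Ke ⊕ U ⊕ V relative to an idempotent e of weight 1, and barideal N = U ⊕ V. For a K-subspace I of A one has NI = I if and only if VI = I (where for subsets X, Y of A, XY is the linear span of products xy with x ∈ X, y ∈ Y). -/

import Mathlib

/-- The product of two subspaces of a (possibly non-associative, non-unital) algebra:
the linear span of all products `x * y` with `x ∈ M`, `y ∈ N`. -/
def subMul {K A : Type*} [Field K] [NonUnitalNonAssocRing A] [Module K A]
    [SMulCommClass K A A] [IsScalarTower K A A]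
    (M N : Submodule K A) : Submodule K A :=
  Submodule.map₂ (LinearMap.mul K A) M N

/-- The Peirce component `U = {u : A | e * u = (1/2) • u}` relative to an idempotent `e`. -/
def peirceU (K : Type*) {A : Type*} [Field K] [NonUnitalNonAssocCommRing A] [Module K A]
    [SMulCommClass K A A] [IsScalarTower K A A] (e : A) : Submodule K A where
  carrier := {u : A | e * u = (2 : K)⁻¹ • u}
  add_mem' := by
    intro a b ha hb
    simp only [Set.mem_setOf_eq] at *
    rw [mul_add, ha, hb, smul_add]
  zero_mem' := by simp
  smul_mem' := by
    intro c x hx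
    simp only [Set.mem_setOf_eq] at *
    rw [mul_smul_comm, hx, smul_comm]

/-- The Peirce component `V = {v : A | e * v = 0}` relative to an idempotent `e`. -/
def peirceV (K : Type*) {A : Type*} [Field K] [NonUnitalNonAssocCommRing A] [Module K A]
    [SMulCommClass K A A] [IsScalarTower K A A] (e : A) : Submodule K A where
  carrier := {v : A | e * v = 0}
  add_mem' := by
    intro a b ha hb
    simp only [Set.mem_setOf_eq] at *
    rw [mul_add, ha, hb, add_zero]
  zero_mem' := by simp
  smul_mem' := by
    intro c x hx
    simp only [Set.mem_setOf_eq] at *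
    rw [mul_smul_comm, hx, smul_zero]

theorem mem_peirceU_iff {K A : Type*} [Field K] [NonUnitalNonAssocCommRing A] [Module K A]
    [SMulCommClass K A A] [IsScalarTower K A A] (h2 : (2 : K) ≠ 0) {e u : A} :
    u ∈ peirceU K e ↔ (2 : K) • (e * u) = u := by
  change e * u = (2 : K)⁻¹ • u ↔ _
  rw [eq_inv_smul_iff₀ h2]

theorem mem_peirceV_iff {K A : Type*} [Field K] [NonUnitalNonAssocCommRing A] [Module K A]
    [SMulCommClass K A A] [IsScalarTower K A A] {e v : A} :
    v ∈ peirceV K e ↔ e * v = 0 := Iff.rfl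

/-- The multiplicative identities satisfied by the Peirce components of a Bernstein algebra. -/
structure PeirceIdentities {K A : Type*} [Field K] [NonUnitalNonAssocCommRing A] [Module K A]
    (U V : Submodule K A) : Prop where
  mul_UU : ∀ {a b}, a ∈ U → b ∈ U → a * b ∈ V
  mul_UV : ∀ {a v}, a ∈ U → v ∈ V → a * v ∈ U
  mul_VV : ∀ {v w}, v ∈ V → w ∈ V → v * w ∈ U
  skew : ∀ {a b v}, a ∈ U → b ∈ U → v ∈ V → a * (b * v) = -(b * (a * v))
  mul_VV_eq_zero : ∀ {a v w}, a ∈ U → v ∈ V → w ∈ V → a * (v * w) = 0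
  cyclic : ∀ {a b c}, a ∈ U → b ∈ U → c ∈ U → a * (b * c) + b * (c * a) + c * (a * b) = 0
  anti : ∀ {a b v w}, a ∈ U → b ∈ U → v ∈ V → w ∈ V → a * (v * (w * b)) = -(a * (w * (v * b)))

theorem add_mul_self_comm {K A : Type*} [Field K] [NonUnitalNonAssocCommRing A]
    [Module K A] (x y : A) :
    (x + y) * (x + y) = x * x + (2 : K) • (x * y) + y * y := by
  rw [add_mul, mul_add, mul_add, mul_comm y x]
  module

theorem mul_eq_zero_of_mul_self_eq_zero {K A : Type*} [Field K] [NonUnitalNonAssocCommRing A]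
    [Module K A] (h2 : (2 : K) ≠ 0) (f : A →ₗ[K] A) {S : Submodule K A}
    (h : ∀ a ∈ S, f a * f a = 0) {a b : A} (ha : a ∈ S) (hb : b ∈ S) : f a * f b = 0 := by
  have := h _ (S.add_mem ha hb)
  rw [map_add, add_mul_self_comm (K := K), h a ha, h b hb] at this
  simpa [h2] using this

section Bernstein

variable {K A : Type*} [Field K] [NonUnitalNonAssocCommRing A] [Module K A]
  [SMulCommClass K A A] [IsScalarTower K A A]

variable {ω : A →ₗ[K] K} {e : A}

theorem bernstein_expansion
    (hbern : ∀ x : A, (x * x) * (x * x) = ω x ^ 2 • (x * x))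
    (he : e * e = e) (hωe : ω e = 1) {n : A} (hn : ω n = 0) (t : K) :
    (4 * t) • (e * (e * n)) + t ^ 2 • ((2 : K) • (e * (n * n)) + (4 : K) • (e * n * (e * n)))
      + (4 * t ^ 3) • (e * n * (n * n)) = (2 * t) • (e * n) + t ^ 2 • (n * n) := by
  have hq : (n * n) * (n * n) = 0 := by simp [hbern, hn]
  have h := hbern (e + t • n)
  have hsq : (e + t • n) * (e + t • n) = e + ((2 * t) • (e * n) + t ^ 2 • (n * n)) := by
    rw [add_mul_self_comm (K := K), he, mul_smul_comm, smul_mul_smul_comm]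
    module
  rw [hsq, add_mul_self_comm (K := K) e, add_mul_self_comm (K := K) ((2 * t) • (e * n)), he] at h
  simp only [mul_add, mul_smul_comm, smul_mul_assoc, hq, map_add, map_smul, hn, hωe,
    smul_eq_mul, mul_zero, add_zero, one_pow, one_smul, smul_zero] at h
  linear_combination (norm := module) h

theorem bernstein_e_mul_e_mul (h2 : (2 : K) ≠ 0) (h3 : (3 : K) ≠ 0)
    (hbern : ∀ x : A, (x * x) * (x * x) = ω x ^ 2 • (x * x))
    (he : e * e = e) (hωe : ω e = 1) {n : A} (hn : ω n = 0) :
    (2 : K) • (e * (e * n)) = e * n := by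
  have h := bernstein_expansion hbern he hωe hn
  have h12 : (3 * 2 ^ 3 : K) ≠ 0 := mul_ne_zero h3 (pow_ne_zero _ h2)
  apply smul_right_injective A h12
  linear_combination (norm := module) (8 : K) • h 1 - (8 : K) • h (-1) - h 2 + h (-2)

theorem bernstein_two_smul_e_mul_sq (h2 : (2 : K) ≠ 0)
    (hbern : ∀ x : A, (x * x) * (x * x) = ω x ^ 2 • (x * x))
    (he : e * e = e) (hωe : ω e = 1) {n : A} (hn : ω n = 0) :
    (2 : K) • (e * (n * n)) + (4 : K) • (e * n * (e * n)) = n * n := by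
  have h := bernstein_expansion hbern he hωe hn
  apply smul_right_injective A h2
  linear_combination (norm := module) h 1 + h (-1)

theorem bernstein_e_mul_mul (h2 : (2 : K) ≠ 0)
    (hbern : ∀ x : A, (x * x) * (x * x) = ω x ^ 2 • (x * x))
    (he : e * e = e) (hωe : ω e = 1) {m n : A} (hm : ω m = 0) (hn : ω n = 0) :
    (2 : K) • (e * (m * n)) + (4 : K) • (e * m * (e * n)) = m * n := by
  have h := @bernstein_two_smul_e_mul_sq K A _ _ _ _ _ _ e h2 hbern he hωe
  have hmn := h (n := m + n) (by simp [hm, hn])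
  rw [mul_add e m n, add_mul_self_comm (K := K) m, add_mul_self_comm (K := K) (e * m)] at hmn
  simp only [mul_add, mul_smul_comm] at hmn
  apply smul_right_injective A h2
  linear_combination (norm := module) hmn - h hm - h hn

theorem bernstein_peirceIdentities (h2 : (2 : K) ≠ 0)
    (hωmul : ∀ x y : A, ω (x * y) = ω x * ω y)
    (hbern : ∀ x : A, (x * x) * (x * x) = ω x ^ 2 • (x * x))
    (he : e * e = e) (hωe : ω e = 1) :
    PeirceIdentities (peirceU K e) (peirceV K e) := by
  have hωU : ∀ {u}, u ∈ peirceU K e → ω u = 0 := fun {u} hu => by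
    have := congrArg ω ((mem_peirceU_iff h2).1 hu)
    rw [map_smul, hωmul, hωe, one_mul, smul_eq_mul] at this
    linear_combination this
  have hωV : ∀ {v}, v ∈ peirceV K e → ω v = 0 := fun {v} hv => by
    have := congrArg ω (mem_peirceV_iff.1 hv)
    rwa [hωmul, hωe, one_mul, map_zero] at this
  have key {m n : A} := @bernstein_e_mul_mul K A _ _ _ _ _ _ e h2 hbern he hωe m n
  have mul_UU : ∀ {a b}, a ∈ peirceU K e → b ∈ peirceU K e → a * b ∈ peirceV K e := by
    intro a b ha hb
    have h := key (hωU ha) (hωU hb)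
    have h' : (4 : K) • (e * a * (e * b)) = a * b := by
      conv_rhs => rw [← (mem_peirceU_iff h2).1 ha, ← (mem_peirceU_iff h2).1 hb]
      rw [smul_mul_smul_comm]
      norm_num
    rw [h', add_eq_right] at h
    exact (smul_eq_zero.1 h).resolve_left h2
  have mul_UV : ∀ {a v}, a ∈ peirceU K e → v ∈ peirceV K e → a * v ∈ peirceU K e := by
    intro a v ha hv
    have h := key (hωU ha) (hωV hv)
    rw [mem_peirceV_iff.1 hv, mul_zero, smul_zero, add_zero] at h
    exact (mem_peirceU_iff h2).2 h
  have mul_VV : ∀ {v w}, v ∈ peirceV K e → w ∈ peirceV K e → v * w ∈ peirceU K e := by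
    intro v w hv hw
    have h := key (hωV hv) (hωV hw)
    rw [mem_peirceV_iff.1 hw, mul_zero, smul_zero, add_zero] at h
    exact (mem_peirceU_iff h2).2 h
  have disj : ∀ {u v}, u ∈ peirceU K e → v ∈ peirceV K e → u + v = 0 → u = 0 ∧ v = 0 := by
    intro u v hu hv h
    have hu0 : u = 0 := by
      have h' := congrArg (e * ·) h
      simp only [mul_add, mem_peirceV_iff.1 hv, add_zero, mul_zero] at h'
      rw [← (mem_peirceU_iff h2).1 hu, h', smul_zero]
    exact ⟨hu0, by simpa [hu0] using h⟩
  -- the identity `(x²)² = x²` at `x = e + u + v`, split into its components in `U` and in `V`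
  have comp : ∀ {u v}, u ∈ peirceU K e → v ∈ peirceV K e →
      (2 : K) • (u * (u * u)) + (4 : K) • (u * v * (u * u)) + (2 : K) • (v * v * (u * u))
        + u * u * (u * u) = 0 ∧
      (4 : K) • (u * (u * v)) + (2 : K) • (u * (v * v)) + (4 : K) • (u * v * (u * v))
        + (4 : K) • (u * v * (v * v)) + v * v * (v * v) = 0 := by
    intro u v hu hv
    have huu := mul_UU hu hu
    have huv := mul_UV hu hv
    have hvv := mul_VV hv hv
    have hx : (e + (u + v)) * (e + (u + v)) =
        e + ((u + (2 : K) • (u * v) + v * v) + u * u) := by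
      rw [add_mul_self_comm (K := K) e, add_mul_self_comm (K := K) u, mul_add e,
        mem_peirceV_iff.1 hv, he]
      linear_combination (norm := module) (mem_peirceU_iff h2).1 hu
    have hp : u + (2 : K) • (u * v) + v * v ∈ peirceU K e :=
      add_mem (add_mem hu (Submodule.smul_mem _ _ huv)) hvv
    have h := hbern (e + (u + v))
    rw [hx] at h
    generalize hpe : u + (2 : K) • (u * v) + v * v = p at h hp
    have hepq : e * (p + u * u) = e * p := by rw [mul_add, mem_peirceV_iff.1 huu, add_zero]
    rw [add_mul_self_comm (K := K) e, add_mul_self_comm (K := K) p, he, hepq,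
      (mem_peirceU_iff h2).1 hp] at h
    simp only [map_add, hωe, hωU hu, hωV hv, add_zero, one_pow, one_smul] at h
    have hd := disj
      (add_mem (Submodule.smul_mem _ (2 : K) (mul_UV hp huu)) (mul_VV huu huu))
      (sub_mem (mul_UU hp hp) huu) (by linear_combination (norm := module) h)
    subst hpe
    refine ⟨?_, ?_⟩
    · rw [← hd.1]
      simp only [add_mul, smul_mul_assoc]
      module
    · rw [← hd.2, add_mul_self_comm (K := K) (u + _), add_mul_self_comm (K := K) u]
      simp only [add_mul, smul_mul_assoc, mul_smul_comm]
      module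
  have vv_vv : ∀ {v}, v ∈ peirceV K e → v * v * (v * v) = 0 := fun {v} hv => by
    simpa using (comp (zero_mem _) hv).2
  have u_uu : ∀ {u}, u ∈ peirceU K e → u * (u * u) = 0 := fun {u} hu => by
    have h₁ := (comp hu (zero_mem _)).1
    have h₂ := (comp (neg_mem hu) (zero_mem _)).1
    simp only [mul_zero, zero_mul, neg_mul, mul_neg, neg_neg] at h₁ h₂
    apply smul_right_injective A (mul_ne_zero h2 h2)
    linear_combination (norm := module) h₁ - h₂
  have even : ∀ {u v}, u ∈ peirceU K e → v ∈ peirceV K e →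
      u * (u * v) = 0 ∧ u * (v * v) = 0 ∧ u * v * (u * v) = 0 := by
    intro u v hu hv
    have h₁ := (comp hu hv).2
    have h₂ := (comp (neg_mem hu) hv).2
    have h₃ := (comp hu (neg_mem hv)).2
    have h₄ := (comp (neg_mem hu) (neg_mem hv)).2
    simp only [vv_vv hv, neg_mul, mul_neg, neg_neg] at h₁ h₂ h₃ h₄
    have h16 : (2 ^ 4 : K) ≠ 0 := pow_ne_zero _ h2
    have h8 : (2 ^ 3 : K) ≠ 0 := pow_ne_zero _ h2
    refine ⟨smul_right_injective A h16 ?_, smul_right_injective A h8 ?_,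
      smul_right_injective A h16 ?_⟩
    · linear_combination (norm := module) h₁ + h₂ - h₃ - h₄
    · linear_combination (norm := module) h₁ - h₂ + h₃ - h₄
    · linear_combination (norm := module) h₁ + h₂ + h₃ + h₄
  have skew : ∀ {a b v}, a ∈ peirceU K e → b ∈ peirceU K e → v ∈ peirceV K e →
      a * (b * v) = -(b * (a * v)) := by
    intro a b v ha hb hv
    have h := (even (add_mem ha hb) hv).1
    simp only [add_mul, mul_add, (even ha hv).1, (even hb hv).1] at h
    linear_combination (norm := module) h
  have square : ∀ {a b}, a ∈ peirceU K e → b ∈ peirceU K e →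
      b * (a * a) + (2 : K) • (a * (a * b)) = 0 := by
    intro a b ha hb
    have h₁ := u_uu (add_mem ha hb)
    have h₂ := u_uu (add_mem ha (neg_mem hb))
    rw [add_mul_self_comm (K := K)] at h₁ h₂
    simp only [mul_add, add_mul, mul_smul_comm, mul_neg, neg_mul, neg_neg, smul_neg,
      u_uu ha, u_uu hb] at h₁ h₂
    apply smul_right_injective A h2
    linear_combination (norm := module) h₁ - h₂
  have pair : ∀ {a b v}, a ∈ peirceU K e → b ∈ peirceU K e → v ∈ peirceV K e →
      a * v * (b * v) = 0 := fun {a b v} ha hb hv =>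
    mul_eq_zero_of_mul_self_eq_zero h2 (LinearMap.mulRight K v)
      (fun x hx => (even hx hv).2.2) ha hb
  have twice : ∀ {a b v}, a ∈ peirceU K e → b ∈ peirceU K e → v ∈ peirceV K e →
      a * (v * (v * b)) = 0 := fun {a b v} ha hb hv => by
    have h := skew ha (mul_UV hb hv) hv
    rw [mul_comm (b * v) (a * v), pair ha hb hv, neg_zero] at h
    rwa [mul_comm v b, mul_comm v]
  refine ⟨mul_UU, mul_UV, mul_VV, skew, ?_, ?_, ?_⟩
  · intro a v w ha hv hw
    have h := (even ha (add_mem hv hw)).2.1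
    rw [add_mul_self_comm (K := K)] at h
    simp only [mul_add, (even ha hv).2.1, (even ha hw).2.1, mul_smul_comm] at h
    simpa [h2] using h
  · intro a b c ha hb hc
    have h := square (add_mem ha hb) hc
    rw [add_mul_self_comm (K := K)] at h
    simp only [mul_add, add_mul, mul_smul_comm] at h
    rw [mul_comm c a]
    apply smul_right_injective A h2
    linear_combination (norm := module) h - square ha hc - square hb hc
  · intro a b v w ha hb hv hw
    have h := twice ha hb (add_mem hv hw)
    simp only [mul_add, add_mul, twice ha hb hv, twice ha hb hw] at h
    linear_combination (norm := module) h

end Bernstein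

section SubMul

variable {K A : Type*} [Field K] [NonUnitalNonAssocCommRing A] [Module K A]
  [SMulCommClass K A A] [IsScalarTower K A A] {M M' N N' P : Submodule K A}

theorem mul_mem_subMul {x y : A} (hx : x ∈ M) (hy : y ∈ N) : x * y ∈ subMul M N :=
  Submodule.apply_mem_map₂ (LinearMap.mul K A) hx hy

theorem subMul_le : subMul M N ≤ P ↔ ∀ x ∈ M, ∀ y ∈ N, x * y ∈ P :=
  Submodule.map₂_le

theorem subMul_mono (hM : M ≤ M') (hN : N ≤ N') : subMul M N ≤ subMul M' N' :=
  Submodule.map₂_le_map₂ hM hN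

theorem subMul_sup_left : subMul (M ⊔ M') N = subMul M N ⊔ subMul M' N :=
  Submodule.map₂_sup_left _ _ _ _

theorem subMul_sup_right : subMul M (N ⊔ N') = subMul M N ⊔ subMul M N' :=
  Submodule.map₂_sup_right _ _ _ _

theorem subMul_self_le_of_mul_self_mem (h2 : (2 : K) ≠ 0) (h : ∀ a ∈ M, a * a ∈ P) :
    subMul M M ≤ P := by
  refine subMul_le.2 fun x hx y hy => ?_
  have hxy := h _ (add_mem hx hy)
  rw [add_mul_self_comm (K := K)] at hxy
  rw [← Submodule.smul_mem_iff P h2]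
  convert sub_mem (sub_mem hxy (h x hx)) (h y hy) using 1
  module

end SubMul

section AnnU

variable {K A : Type*} [Field K] [NonUnitalNonAssocCommRing A] [Module K A]
  [SMulCommClass K A A]

/-- The elements of `U` annihilated by all of `U`. -/
def annU (U : Submodule K A) : Submodule K A where
  carrier := {x | x ∈ U ∧ ∀ a ∈ U, a * x = 0}
  add_mem' := fun hx hy => ⟨add_mem hx.1 hy.1, fun a ha => by
    rw [mul_add, hx.2 a ha, hy.2 a ha, add_zero]⟩
  zero_mem' := ⟨zero_mem _, fun a _ => mul_zero a⟩
  smul_mem' := fun c _ hx => ⟨Submodule.smul_mem _ c hx.1, fun a ha => by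
    rw [mul_smul_comm, hx.2 a ha, smul_zero]⟩

theorem annU_le (U : Submodule K A) : annU U ≤ U := fun _ hx => hx.1

end AnnU

namespace PeirceIdentities

variable {K A : Type*} [Field K] [NonUnitalNonAssocCommRing A] [Module K A]
  {U V : Submodule K A}

theorem mul_VU (hP : PeirceIdentities U V) {v a : A} (hv : v ∈ V) (ha : a ∈ U) : v * a ∈ U :=
  mul_comm a v ▸ hP.mul_UV ha hv

theorem skew' (hP : PeirceIdentities U V) {x y w : A} (hx : x ∈ U) (hy : y ∈ U) (hw : w ∈ V) :
    (w * x) * y = -((w * y) * x) := by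
  rw [mul_comm _ y, mul_comm w x, hP.skew hy hx hw, mul_comm x, mul_comm y w]

theorem anti' (hP : PeirceIdentities U V) {x y v w : A} (hx : x ∈ U) (hy : y ∈ U) (hv : v ∈ V)
    (hw : w ∈ V) : (v * (w * x)) * y = -((w * (v * x)) * y) := by
  rw [mul_comm _ y, hP.anti hy hx hv hw, mul_comm y]

theorem anti_inner (hP : PeirceIdentities U V) {x y v w z : A} (hx : x ∈ U) (hy : y ∈ U)
    (hv : v ∈ V) (hw : w ∈ V) (hz : z ∈ V) :
    (z * (v * (w * x))) * y = -((z * (w * (v * x))) * y) := by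
  rw [hP.skew' (hP.mul_VU hv (hP.mul_VU hw hx)) hy hz, mul_comm (z * y),
    hP.skew' (hP.mul_VU hw (hP.mul_VU hv hx)) hy hz, mul_comm (z * y), mul_comm _ (z * y),
    mul_comm _ (z * y), hP.anti (hP.mul_VU hz hy) hx hv hw]

theorem two_smul_mul_mul_self (hP : PeirceIdentities U V) {a x : A} (ha : a ∈ U) (hx : x ∈ U) :
    (a * a) * x = (-2 : K) • ((a * x) * a) := by
  have h := hP.cyclic hx ha ha
  rw [mul_comm x (a * a), mul_comm x a, mul_comm a (a * x)] at h
  linear_combination (norm := module) h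

variable [SMulCommClass K A A]

theorem mul_VV_mem_annU (hP : PeirceIdentities U V) {v w : A} (hv : v ∈ V) (hw : w ∈ V) :
    v * w ∈ annU U :=
  ⟨hP.mul_VV hv hw, fun _ ha => hP.mul_VV_eq_zero ha hv hw⟩

theorem mul_mem_annU (hP : PeirceIdentities U V) {v x : A} (hv : v ∈ V) (hx : x ∈ annU U) :
    v * x ∈ annU U :=
  ⟨hP.mul_VU hv hx.1, fun a ha => by
    rw [mul_comm v, hP.skew ha hx.1 hv, mul_comm, hx.2 _ (hP.mul_UV ha hv), neg_zero]⟩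

theorem anti_mem_annU (hP : PeirceIdentities U V) {v w b : A} (hv : v ∈ V) (hw : w ∈ V)
    (hb : b ∈ U) : v * (w * b) + w * (v * b) ∈ annU U :=
  ⟨add_mem (hP.mul_VU hv (hP.mul_VU hw hb)) (hP.mul_VU hw (hP.mul_VU hv hb)), fun a ha => by
    rw [mul_add, hP.anti ha hb hv hw, neg_add_cancel]⟩

theorem mul_mul_self_mem_annU (hP : PeirceIdentities U V) (h2 : (2 : K) ≠ 0) {v b : A}
    (hv : v ∈ V) (hb : b ∈ U) : v * (v * b) ∈ annU U := by
  rw [← Submodule.smul_mem_iff _ h2]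
  convert hP.anti_mem_annU hv hv hb using 1
  module

variable [IsScalarTower K A A] {J : Submodule K A}

/-! ### Nilpotency of the action of `UU` -/

theorem squares_cycle (hP : PeirceIdentities U V) {a b c x : A} (ha : a ∈ U)
    (hb : b ∈ U) (hc : c ∈ U) (hx : x ∈ U) :
    (a * a * (b * b * (c * c * x))) * x = (b * b * (c * c * (x * x * a))) * a := by
  have hbb := hP.mul_UU hb hb
  have hcc := hP.mul_UU hc hc
  have hax := hP.mul_UU ha hx
  have hcx := hP.mul_VU hcc hx
  have hy := hP.mul_VU hbb hcx
  rw [hP.skew' hy hx (hP.mul_UU ha ha), hP.two_smul_mul_mul_self (K := K) ha hx, smul_mul_assoc,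
    mul_comm (a * x * a), mul_comm (a * x) a, mul_comm _ (a * (a * x)), mul_comm a (a * x),
    hP.skew' ha hy hax, hP.anti' hcx ha hax hbb, hP.anti_inner hx ha hax hcc hbb,
    hP.two_smul_mul_mul_self (K := K) hx ha, mul_comm x a]
  simp only [mul_smul_comm, smul_mul_assoc]
  module

theorem squares_mul_self_eq_zero (hP : PeirceIdentities U V) (h2 : (2 : K) ≠ 0) {a b c x : A}
    (ha : a ∈ U) (hb : b ∈ U) (hc : c ∈ U) (hx : x ∈ U) :
    (a * a * (b * b * (c * c * x))) * x = 0 := by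
  have swap {a b c x : A} (ha : a ∈ U) (hb : b ∈ U) (hc : c ∈ U) (hx : x ∈ U) :
      (a * a * (b * b * (c * c * x))) * x = -((b * b * (a * a * (c * c * x))) * x) :=
    hP.anti' (hP.mul_VU (hP.mul_UU hc hc) hx) hx (hP.mul_UU ha ha) (hP.mul_UU hb hb)
  have h : (a * a * (b * b * (c * c * x))) * x = -((a * a * (b * b * (c * c * x))) * x) := by
    conv_lhs => rw [hP.squares_cycle ha hb hc hx, swap hb hc hx ha,
      hP.squares_cycle hc hb hx ha, swap hb hx ha hc, hP.squares_cycle hx hb ha hc,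
      swap hb ha hc hx]
    simp
  apply smul_right_injective A h2
  linear_combination (norm := module) h

theorem subMul_UU_cube_le (hP : PeirceIdentities U V) (h2 : (2 : K) ≠ 0) (hJ : J ≤ U) :
    subMul (subMul U U) (subMul (subMul U U) (subMul (subMul U U) J)) ≤ annU U := by
  have hUU : subMul U U ≤ V := subMul_le.2 fun a ha b hb => hP.mul_UU ha hb
  have h₀ {a b c x y : A} (ha : a ∈ U) (hb : b ∈ U) (hc : c ∈ U) (hx : x ∈ U) (hy : y ∈ U) :
      (a * a * (b * b * (c * c * x))) * y = 0 := by
    have haa := hP.mul_UU ha ha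
    have hbb := hP.mul_UU hb hb
    have hcc := hP.mul_UU hc hc
    have h := hP.squares_mul_self_eq_zero h2 ha hb hc (add_mem hx hy)
    simp only [mul_add, add_mul, hP.squares_mul_self_eq_zero h2 ha hb hc hx,
      hP.squares_mul_self_eq_zero h2 ha hb hc hy] at h
    have hsymm : (a * a * (b * b * (c * c * y))) * x = (a * a * (b * b * (c * c * x))) * y := by
      rw [hP.skew' (hP.mul_VU hbb (hP.mul_VU hcc hy)) hx haa, mul_comm _ (b * b * _),
        mul_comm _ (a * a * x), mul_comm (a * a * x),
        hP.skew' (hP.mul_VU hcc hy) (hP.mul_VU haa hx) hbb, mul_comm _ (c * c * y),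
        hP.skew' hy (hP.mul_VU hbb (hP.mul_VU haa hx)) hcc,
        hP.anti' (hP.mul_VU haa hx) hy hcc hbb, hP.anti_inner hx hy hcc haa hbb,
        hP.anti' (hP.mul_VU hcc hx) hy hbb haa]
      simp
    rw [hsymm] at h
    apply smul_right_injective A h2
    linear_combination (norm := module) h
  have h₁ {a b x y w : A} (ha : a ∈ U) (hb : b ∈ U) (hx : x ∈ U) (hy : y ∈ U)
      (hw : w ∈ subMul U U) : (a * a * (b * b * (w * x))) * y = 0 := by
    have : subMul U U ≤ LinearMap.ker (LinearMap.mulRight K y ∘ₗ LinearMap.mulLeft K (a * a) ∘ₗ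
        LinearMap.mulLeft K (b * b) ∘ₗ LinearMap.mulRight K x) :=
      subMul_self_le_of_mul_self_mem h2 fun c hc => h₀ ha hb hc hx hy
    exact this hw
  have h₂ {a x y v w : A} (ha : a ∈ U) (hx : x ∈ U) (hy : y ∈ U)
      (hv : v ∈ subMul U U) (hw : w ∈ subMul U U) : (a * a * (v * (w * x))) * y = 0 := by
    have : subMul U U ≤ LinearMap.ker (LinearMap.mulRight K y ∘ₗ LinearMap.mulLeft K (a * a) ∘ₗ
        LinearMap.mulRight K (w * x)) :=
      subMul_self_le_of_mul_self_mem h2 fun b hb => h₁ ha hb hx hy hw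
    exact this hv
  have h₃ {x y z v w : A} (hx : x ∈ U) (hy : y ∈ U) (hz : z ∈ subMul U U)
      (hv : v ∈ subMul U U) (hw : w ∈ subMul U U) : (z * (v * (w * x))) * y = 0 := by
    have : subMul U U ≤ LinearMap.ker (LinearMap.mulRight K y ∘ₗ
        LinearMap.mulRight K (v * (w * x))) :=
      subMul_self_le_of_mul_self_mem h2 fun a ha => h₂ ha hx hy hv hw
    exact this hz
  refine subMul_le.2 fun z hz p hp => ?_
  suffices subMul (subMul U U) (subMul (subMul U U) J) ≤
      (annU U).comap (LinearMap.mulLeft K z) from this hp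
  refine subMul_le.2 fun v hv q hq => ?_
  suffices subMul (subMul U U) J ≤
      (annU U).comap (LinearMap.mulLeft K z ∘ₗ LinearMap.mulLeft K v) from this hq
  refine subMul_le.2 fun w hw x hx => ?_
  exact ⟨hP.mul_VU (hUU hz) (hP.mul_VU (hUU hv) (hP.mul_VU (hUU hw) (hJ hx))),
    fun y hy => by rw [mul_comm]; exact h₃ (hJ hx) hy hz hv hw⟩

theorem subMul_annU_le (hP : PeirceIdentities U V) {W : Submodule K A} (hW : W ≤ V) :
    subMul W (annU U) ≤ annU U :=
  subMul_le.2 fun _ hv _ hx => hP.mul_mem_annU (hW hv) hx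

theorem le_annU_of_le_subMul_UU (hP : PeirceIdentities U V) (h2 : (2 : K) ≠ 0) (hJU : J ≤ U)
    (hJ : J ≤ subMul (subMul U U) J ⊔ annU U) : J ≤ annU U := by
  have hUU : subMul U U ≤ V := subMul_le.2 fun a ha b hb => hP.mul_UU ha hb
  have step {X : Submodule K A} (hX : J ≤ X ⊔ annU U) :
      J ≤ subMul (subMul U U) X ⊔ annU U := by
    refine hJ.trans (sup_le ((subMul_mono le_rfl hX).trans ?_) le_sup_right)
    rw [subMul_sup_right]
    exact sup_le_sup_left (hP.subMul_annU_le hUU) _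
  exact (step (step hJ)).trans (sup_le (hP.subMul_UU_cube_le h2 hJU) le_rfl)

/-! ### Removing finitely many operators -/

theorem le_subMul_of_le_subMul_sup_singleton (hP : PeirceIdentities U V) (h2 : (2 : K) ≠ 0)
    (hJU : J ≤ U) (hVJ : subMul V J ≤ J) {W : Submodule K A} (hW : W ≤ V) {v : A} (hv : v ∈ V)
    (hJ : J ≤ subMul (W ⊔ K ∙ v) J ⊔ annU U) : J ≤ subMul W J ⊔ annU U := by
  have hvJ {x : A} (hx : x ∈ J) : v * x ∈ subMul W J ⊔ annU U := by
    suffices J ≤ (subMul W J ⊔ annU U).comap (LinearMap.mulLeft K v) from this hx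
    refine hJ.trans (sup_le ?_ fun l hl => ?_)
    · rw [subMul_sup_left]
      refine sup_le (subMul_le.2 fun w hw y hy => ?_) (subMul_le.2 fun z hz y hy => ?_)
      · have h₁ := Submodule.mem_sup_right (S := subMul W J)
          (hP.anti_mem_annU hv (hW hw) (hJU hy))
        have h₂ := Submodule.mem_sup_left (T := annU U)
          (mul_mem_subMul hw (hVJ (mul_mem_subMul hv hy)))
        simpa using sub_mem h₁ h₂
      · obtain ⟨c, rfl⟩ := Submodule.mem_span_singleton.1 hz
        simp only [Submodule.mem_comap, LinearMap.mulLeft_apply, smul_mul_assoc, mul_smul_comm]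
        exact Submodule.mem_sup_right
          (Submodule.smul_mem _ c (hP.mul_mul_self_mem_annU h2 hv (hJU hy)))
    · exact Submodule.mem_sup_right (hP.mul_mem_annU hv hl)
  refine hJ.trans (sup_le ?_ le_sup_right)
  rw [subMul_sup_left]
  refine sup_le le_sup_left (subMul_le.2 fun z hz y hy => ?_)
  obtain ⟨c, rfl⟩ := Submodule.mem_span_singleton.1 hz
  rw [smul_mul_assoc]
  exact Submodule.smul_mem _ c (hvJ hy)

theorem le_annU_of_le_subMul_V (hP : PeirceIdentities U V) (h2 : (2 : K) ≠ 0)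
    {s : Finset A} (hs : (s : Set A) ⊆ V) (hVs : V ≤ subMul U U ⊔ Submodule.span K s)
    (hJU : J ≤ U) (hVJ : subMul V J ≤ J) (hJ : J ≤ subMul V J ⊔ annU U) : J ≤ annU U := by
  classical
  have hUU : subMul U U ≤ V := subMul_le.2 fun a ha b hb => hP.mul_UU ha hb
  apply hP.le_annU_of_le_subMul_UU h2 hJU
  replace hJ := hJ.trans (sup_le_sup_right (subMul_mono hVs le_rfl) _)
  clear hVs
  induction s using Finset.induction_on with
  | empty => simpa using hJ
  | insert v s _ ih =>
    rw [Finset.coe_insert, Set.insert_subset_iff] at hs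
    refine ih hs.2 (hP.le_subMul_of_le_subMul_sup_singleton h2 hJU hVJ
      (sup_le hUU (Submodule.span_le.2 hs.2)) hs.1 ?_)
    rwa [Finset.coe_insert, Submodule.span_insert, sup_comm (K ∙ v), ← sup_assoc] at hJ

theorem VU_mul_UJ_mem (hP : PeirceIdentities U V) (hJU : J ≤ U)
    (hUUJ : subMul U (subMul U J) ≤ J) {v a b x : A} (hv : v ∈ V) (ha : a ∈ U) (hb : b ∈ U)
    (hx : x ∈ J) :
    (v * b) * (a * x) ∈ subMul V J ⊔ annU U := by
  have h₁ := Submodule.mem_sup_right (S := subMul V J)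
    (hP.anti_mem_annU (hP.mul_UU ha (hJU hx)) hv hb)
  have h₂ := Submodule.mem_sup_left (T := annU U) (mul_mem_subMul hv
    (hUUJ (mul_mem_subMul hb (mul_mem_subMul ha hx))))
  have h := sub_mem h₁ h₂
  rwa [mul_comm b (a * x), add_sub_cancel_right, mul_comm] at h

theorem UUVJ_mem (hP : PeirceIdentities U V) (hJU : J ≤ U)
    (hUUJ : subMul U (subMul U J) ≤ J)
    {v a b x : A} (hv : v ∈ V) (ha : a ∈ U) (hb : b ∈ U) (hx : x ∈ J) :
    a * (b * (v * x)) ∈ subMul V J ⊔ annU U := by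
  have hxU := hJU hx
  have h₁ := hP.VU_mul_UJ_mem hJU hUUJ hv ha hb hx
  have h₂ := Submodule.mem_sup_left (T := annU U)
    (mul_mem_subMul (hP.mul_UU (hP.mul_VU hv hb) ha) hx)
  have hc := hP.cyclic ha hxU (hP.mul_VU hv hb)
  have h : a * (b * (v * x)) = (v * b) * (a * x) + (v * b * a) * x := by
    rw [mul_comm v x, hP.skew hb hxU hv, mul_neg, mul_comm b v, mul_comm (v * b * a) x]
    linear_combination (norm := module) -hc
  rw [h]
  exact add_mem h₁ h₂

theorem UU_mul_mem (hP : PeirceIdentities U V) (hJU : J ≤ U)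
    (hUUJ : subMul U (subMul U J) ≤ J)
    {a b z : A} (ha : a ∈ U) (hb : b ∈ U) (hz : z ∈ subMul V J ⊔ annU U) :
    a * (b * z) ∈ subMul V J ⊔ annU U := by
  suffices subMul V J ⊔ annU U ≤
      (subMul V J ⊔ annU U).comap (LinearMap.mulLeft K a ∘ₗ LinearMap.mulLeft K b) from this hz
  refine sup_le (subMul_le.2 fun v hv x hx => hP.UUVJ_mem hJU hUUJ hv ha hb hx)
    fun l hl => ?_
  simp [hl.2 b hb]

theorem le_subMul_subMul_of_le_sup_singleton (hP : PeirceIdentities U V) (hJU : J ≤ U)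
    (hUUJ : subMul U (subMul U J) ≤ J) (h2 : (2 : K) ≠ 0) {W : Submodule K A} (hW : W ≤ U)
    {f : A} (hf : f ∈ U)
    (hJ : J ≤ subMul (W ⊔ K ∙ f) (subMul (W ⊔ K ∙ f) J) ⊔ (subMul V J ⊔ annU U)) :
    J ≤ subMul W (subMul W J) ⊔ (subMul V J ⊔ annU U) := by
  set Z := subMul V J ⊔ annU U with hZ
  have hUUZ {a b z : A} (ha : a ∈ U) (hb : b ∈ U) (hz : z ∈ Z) : a * (b * z) ∈ Z :=
    hP.UU_mul_mem hJU hUUJ ha hb hz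
  have hUUJ' {a b x : A} (ha : a ∈ U) (hb : b ∈ U) (hx : x ∈ J) : a * (b * x) ∈ J :=
    hUUJ (mul_mem_subMul ha (mul_mem_subMul hb hx))
  -- a submodule contains `(W + Kf)((W + Kf)J)` as soon as it contains the four kinds of products
  have split {P : Submodule K A} (hww : ∀ w ∈ W, ∀ w' ∈ W, ∀ x ∈ J, w * (w' * x) ∈ P)
      (hwf : ∀ w ∈ W, ∀ x ∈ J, w * (f * x) ∈ P) (hfw : ∀ w ∈ W, ∀ x ∈ J, f * (w * x) ∈ P)
      (hff : ∀ x ∈ J, f * (f * x) ∈ P) :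
      subMul (W ⊔ K ∙ f) (subMul (W ⊔ K ∙ f) J) ≤ P := by
    refine subMul_le.2 fun m hm q hq => ?_
    suffices subMul (W ⊔ K ∙ f) J ≤ P.comap (LinearMap.mulLeft K m) from this hq
    refine subMul_le.2 fun m' hm' x hx => ?_
    obtain ⟨w, hw, z, hz, rfl⟩ := Submodule.mem_sup.1 hm
    obtain ⟨w', hw', z', hz', rfl⟩ := Submodule.mem_sup.1 hm'
    obtain ⟨c, rfl⟩ := Submodule.mem_span_singleton.1 hz
    obtain ⟨c', rfl⟩ := Submodule.mem_span_singleton.1 hz'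
    simp only [Submodule.mem_comap, LinearMap.mulLeft_apply, add_mul, mul_add, smul_mul_assoc,
      mul_smul_comm]
    exact add_mem (add_mem (hww w hw w' hw' x hx) (P.smul_mem _ (hfw w' hw' x hx)))
      (P.smul_mem _ (add_mem (hwf w hw x hx) (P.smul_mem _ (hff x hx))))
  have hff {x : A} (hx : x ∈ J) : f * (f * x) ∈ Z := by
    have h := Submodule.mem_sup_left (T := annU U) (mul_mem_subMul (hP.mul_UU hf hf) hx)
    rw [hP.two_smul_mul_mul_self (K := K) hf (hJU hx), Submodule.smul_mem_iff _ (neg_ne_zero.2 h2)]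
      at h
    rwa [mul_comm] at h
  have hwf : ∀ w ∈ W, ∀ x ∈ J, w * (f * x) ∈ subMul W (subMul W J) ⊔ Z := by
    intro w hw x hx
    suffices J ≤ (subMul W (subMul W J) ⊔ Z).comap
        (LinearMap.mulLeft K w ∘ₗ LinearMap.mulLeft K f) from this hx
    have hwU := hW hw
    have hfW {m : A} (hm : m ∈ U) {w₁ : A} (hw₁ : w₁ ∈ W) {x : A} (hx : x ∈ J) :
        w * (f * (w₁ * (m * x))) ∈ subMul W (subMul W J) ⊔ Z := by
      rw [hP.skew hf (hW hw₁) (hP.mul_UU hm (hJU hx)), mul_neg]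
      exact neg_mem (Submodule.mem_sup_left
        (mul_mem_subMul hw (mul_mem_subMul hw₁ (hUUJ' hf hm hx))))
    have hff' {m : A} (hm : m ∈ U) {x : A} (hx : x ∈ J) : f * (f * (m * x)) = 0 := by
      have h := hP.skew hf hf (hP.mul_UU hm (hJU hx))
      apply smul_right_injective A h2
      linear_combination (norm := module) h
    refine hJ.trans (sup_le (split ?_ ?_ ?_ ?_) fun z hz =>
      Submodule.mem_sup_right (hUUZ hwU hf hz))
    · exact fun w₁ hw₁ w₂ hw₂ x hx => hfW (hW hw₂) hw₁ hx
    · exact fun w₁ hw₁ x hx => hfW hf hw₁ hx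
    · intro w₁ hw₁ x hx
      simp [hff' (hW hw₁) hx]
    · intro x hx
      simp [hff' hf hx]
  refine hJ.trans (sup_le (split ?_ hwf ?_ ?_) le_sup_right)
  · exact fun w hw w' hw' x hx =>
      Submodule.mem_sup_left (mul_mem_subMul hw (mul_mem_subMul hw' hx))
  · intro w hw x hx
    have hc := hP.cyclic hf (hW hw) (hJU hx)
    have h : f * (w * x) = -(w * (f * x)) - (f * w) * x := by
      rw [mul_comm (f * w), mul_comm f x]
      linear_combination (norm := module) hc
    rw [h]
    exact sub_mem (neg_mem (hwf w hw x hx)) (Submodule.mem_sup_right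
      (Submodule.mem_sup_left (mul_mem_subMul (hP.mul_UU hf (hW hw)) hx)))
  · exact fun x hx => Submodule.mem_sup_right (hff hx)

theorem le_subMul_V_of_le_sup (hP : PeirceIdentities U V) (hJU : J ≤ U)
    (hUUJ : subMul U (subMul U J) ≤ J) (h2 : (2 : K) ≠ 0) {s : Finset A} (hs : (s : Set A) ⊆ U)
    (hUs : U ≤ (subMul V U ⊔ subMul V V) ⊔ Submodule.span K s)
    (hJ : J ≤ subMul U (subMul U J) ⊔ (subMul V J ⊔ annU U)) : J ≤ subMul V J ⊔ annU U := by
  classical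
  set W := subMul V U ⊔ subMul V V
  have hWU : W ≤ U := sup_le (subMul_le.2 fun v hv a ha => hP.mul_VU hv ha)
    (subMul_le.2 fun v hv w hw => hP.mul_VV hv hw)
  have hW : subMul W (subMul W J) ≤ subMul V J ⊔ annU U := by
    refine (subMul_mono le_rfl (subMul_mono hWU le_rfl)).trans (subMul_le.2 fun y hy z hz => ?_)
    suffices subMul U J ≤ (subMul V J ⊔ annU U).comap (LinearMap.mulLeft K y) from this hz
    refine subMul_le.2 fun a ha x hx => ?_
    suffices W ≤ (subMul V J ⊔ annU U).comap (LinearMap.mulRight K (a * x)) from this hy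
    refine sup_le (subMul_le.2 fun v hv b hb => hP.VU_mul_UJ_mem hJU hUUJ hv ha hb hx)
      (subMul_le.2 fun v hv w hw => Submodule.mem_sup_right ?_)
    rw [LinearMap.mulRight_apply, mul_comm]
    exact hP.mul_mem_annU (hP.mul_UU ha (hJU hx)) (hP.mul_VV_mem_annU hv hw)
  suffices J ≤ subMul W (subMul W J) ⊔ (subMul V J ⊔ annU U) from this.trans (sup_le hW le_rfl)
  replace hJ := hJ.trans (sup_le_sup_right (subMul_mono hUs (subMul_mono hUs le_rfl)) _)
  clear hUs
  induction s using Finset.induction_on with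
  | empty => simpa using hJ
  | insert v s _ ih =>
    rw [Finset.coe_insert, Set.insert_subset_iff] at hs
    refine ih hs.2 (hP.le_subMul_subMul_of_le_sup_singleton hJU hUUJ h2
      (sup_le hWU (Submodule.span_le.2 hs.2)) hs.1 ?_)
    rwa [Finset.coe_insert, Submodule.span_insert, sup_comm (K ∙ v), ← sup_assoc W] at hJ

end PeirceIdentities

section ChainCondition

variable {K A : Type*} [Field K] [AddCommGroup A] [Module K A]

/-- A chain condition on a family of submodules. -/
def ChainCondition (p : Submodule K A → Prop) : Prop :=
  (∀ f : ℕ → Submodule K A, (∀ k, p (f k)) → Monotone f → ∃ n, ∀ m, n ≤ m → f m = f n) ∨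
    (∀ f : ℕ → Submodule K A, (∀ k, p (f k)) → Antitone f → ∃ n, ∀ m, n ≤ m → f m = f n)

theorem ChainCondition.exists_finset {p : Submodule K A → Prop} (hp : ChainCondition p)
    {P Q C : Submodule K A} (hPQ : P ≤ Q) (hQC : Disjoint C Q)
    (hR : ∀ R, P ≤ R → R ≤ Q → p (R ⊔ C)) :
    ∃ s : Finset A, (s : Set A) ⊆ Q ∧ Q ≤ P ⊔ Submodule.span K s := by
  classical
  let Q' := Q.map P.mkQ
  let g : Submodule K Q' → Submodule K A := fun R => (R.map Q'.subtype).comap P.mkQ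
  have hg_le (R) : g R ≤ Q := by
    have : Submodule.comap P.mkQ Q' = Q := by
      rw [Submodule.comap_map_eq, Submodule.ker_mkQ, sup_eq_left.2 hPQ]
    exact (Submodule.comap_mono (Submodule.map_subtype_le _ _)).trans this.le
  have hle_g (R) : P ≤ g R := by
    conv_lhs => rw [← P.ker_mkQ]
    exact LinearMap.ker_le_comap _
  have hg_inj : Function.Injective g :=
    (Submodule.comap_injective_of_surjective P.mkQ_surjective).comp
      (Submodule.map_injective_of_injective Q'.subtype_injective)
  have hg_mono : Monotone g := fun _ _ h => Submodule.comap_mono (Submodule.map_mono h)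
  have hC_inj {R S} (h : g R ⊔ C = g S ⊔ C) : R = S := by
    have key (T) : (g T ⊔ C) ⊓ Q = g T := by
      rw [sup_inf_assoc_of_le _ (hg_le T), hQC.eq_bot, sup_bot_eq]
    exact hg_inj (by rw [← key R, h, key S])
  have hfin : Module.Finite K Q' := by
    rcases hp with hp | hp
    · have : IsNoetherian K Q' := monotone_stabilizes_iff_noetherian.1 fun f => by
        obtain ⟨n, hn⟩ := hp (fun k => g (f k) ⊔ C) (fun k => hR _ (hle_g _) (hg_le _))
          fun _ _ h => sup_le_sup_right (hg_mono (f.monotone h)) C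
        exact ⟨n, fun m hm => (hC_inj (hn m hm)).symm⟩
      infer_instance
    · have : IsArtinian K Q' := monotone_stabilizes_iff_artinian.1 fun f => by
        obtain ⟨n, hn⟩ := hp (fun k => g (f k).ofDual ⊔ C) (fun k => hR _ (hle_g _) (hg_le _))
          fun _ _ h => sup_le_sup_right (hg_mono (f.monotone h)) C
        exact ⟨n, fun m hm => (congrArg OrderDual.toDual (hC_inj (hn m hm))).symm⟩
      exact (IsSemisimpleModule.finite_tfae.out 0 2).2 this
  obtain ⟨t, ht⟩ := Module.Finite.iff_fg.1 hfin
  have htQ : (t : Set (A ⧸ P)) ⊆ P.mkQ '' Q := by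
    rw [← Submodule.map_coe]
    exact Submodule.span_le.1 ht.le
  obtain ⟨s, hs, rfl⟩ := Finset.subset_set_image_iff.1 htQ
  refine ⟨s, hs, ?_⟩
  rw [Finset.coe_image, Submodule.span_image] at ht
  have h := Submodule.map_le_iff_le_comap.1 ht.ge
  rwa [Submodule.comap_map_eq, Submodule.ker_mkQ, sup_comm] at h

end ChainCondition

section Peirce

variable {K A : Type*} [Field K] [NonUnitalNonAssocCommRing A] [Module K A]
  [SMulCommClass K A A] [IsScalarTower K A A] {e : A}

theorem disjoint_peirceU_peirceV (h2 : (2 : K) ≠ 0) :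
    Disjoint (peirceU K e) (peirceV K e) :=
  Submodule.disjoint_def.2 fun x hU hV => by
    rw [← (mem_peirceU_iff h2).1 hU, mem_peirceV_iff.1 hV, smul_zero]

theorem exists_peirce_decomposition (h2 : (2 : K) ≠ 0) (h3 : (3 : K) ≠ 0) {ω : A →ₗ[K] K}
    (hbern : ∀ x : A, (x * x) * (x * x) = ω x ^ 2 • (x * x))
    (he : e * e = e) (hωe : ω e = 1) (a : A) :
    ∃ c : K, ∃ u ∈ peirceU K e, ∃ v ∈ peirceV K e, a = c • e + u + v := by
  set n := a - ω a • e with hn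
  have hωn : ω n = 0 := by simp [hn, hωe]
  have h := bernstein_e_mul_e_mul h2 h3 hbern he hωe hωn
  refine ⟨ω a, (2 : K) • (e * n), ?_, n - (2 : K) • (e * n), ?_, by rw [hn]; abel⟩
  · exact Submodule.smul_mem _ _ ((mem_peirceU_iff h2).2 h)
  · rw [mem_peirceV_iff, mul_sub, mul_smul_comm, h, sub_self]

theorem mul_mem_sup_of_peirce_decomposition
    {U' V' : Submodule K A} (hdec : ∀ a : A, ∃ c : K, ∃ u ∈ peirceU K e, ∃ v ∈ peirceV K e,
      a = c • e + u + v) (hU : U' ≤ peirceU K e) (hV : V' ≤ peirceV K e)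
    (hUU : subMul (peirceU K e) U' ≤ V') (hVU : subMul (peirceV K e) U' ≤ U')
    (hUV : subMul (peirceU K e) V' ≤ U') (hVV : subMul (peirceV K e) V' ≤ U')
    (a x : A) (hx : x ∈ U' ⊔ V') : a * x ∈ U' ⊔ V' := by
  obtain ⟨c, u, hu, v, hv, rfl⟩ := hdec a
  obtain ⟨y, hy, z, hz, rfl⟩ := Submodule.mem_sup.1 hx
  have hey : e * y = (2 : K)⁻¹ • y := hU hy
  have hez : e * z = 0 := hV hz
  have hU' {w : A} (hw : w ∈ U') : w ∈ U' ⊔ V' := Submodule.mem_sup_left hw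
  simp only [add_mul, mul_add, smul_mul_assoc, hey, hez, smul_zero, zero_add]
  exact add_mem (add_mem (add_mem (hU' (U'.smul_mem _ (U'.smul_mem _ hy)))
    (Submodule.mem_sup_right (hUU (mul_mem_subMul hu hy))))
    (hU' (hVU (mul_mem_subMul hv hy))))
    (add_mem (hU' (hUV (mul_mem_subMul hu hz))) (hU' (hVV (mul_mem_subMul hv hz))))

end Peirce

namespace PeirceIdentities

variable {K A : Type*} [Field K] [NonUnitalNonAssocCommRing A] [Module K A]
  [SMulCommClass K A A] [IsScalarTower K A A] {U V I : Submodule K A}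

theorem le_annU_of_subMul_sup_eq (hP : PeirceIdentities U V) (h2 : (2 : K) ≠ 0)
    (hUV : Disjoint U V) {s t : Finset A} (hs : (s : Set A) ⊆ V)
    (hVs : V ≤ subMul U U ⊔ Submodule.span K s) (ht : (t : Set A) ⊆ U)
    (hUt : U ≤ (subMul V U ⊔ subMul V V) ⊔ Submodule.span K t) (hIN : I ≤ U ⊔ V)
    (hI : subMul (U ⊔ V) I = I) : I ≤ annU U := by
  have hNI {n i : A} (hn : n ∈ U ⊔ V) (hi : i ∈ I) : n * i ∈ I :=
    hI.le (mul_mem_subMul hn hi)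
  -- `J` is the projection of `I` to `U` along `V`, enlarged by `annU U`
  let J := (I ⊔ V) ⊓ U ⊔ annU U
  have hJU : J ≤ U := sup_le inf_le_right (annU_le U)
  have mem_J {i v : A} (hi : i ∈ I) (hv : v ∈ V) (hU : i + v ∈ U) : i + v ∈ J :=
    Submodule.mem_sup_left ⟨Submodule.add_mem_sup hi hv, hU⟩
  have J_le {P : Submodule K A} (hI : (I ⊔ V) ⊓ U ≤ P) (hL : annU U ≤ P) : J ≤ P := sup_le hI hL
  have hLJ : annU U ≤ J := le_sup_right
  clear_value J
  have hUJV : subMul U J ≤ V := subMul_le.2 fun a ha x hx => hP.mul_UU ha (hJU hx)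
  have hVJ : subMul V J ≤ J := subMul_le.2 fun v hv => by
    suffices J ≤ J.comap (LinearMap.mulLeft K v) from this
    refine J_le ?_ fun l hl => hLJ (hP.mul_mem_annU hv hl)
    rintro x ⟨hx, hxU⟩
    obtain ⟨i, hi, w, hw, rfl⟩ := Submodule.mem_sup.1 hx
    have hvw := hP.mul_VV_mem_annU hv hw
    have hvi : v * i + 0 ∈ J := by
      refine mem_J (hNI (Submodule.mem_sup_right hv) hi) (zero_mem V) ?_
      have := sub_mem (hP.mul_VU hv hxU) hvw.1
      rwa [mul_add, add_sub_cancel_right, ← add_zero (v * i)] at this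
    rw [add_zero] at hvi
    change v * (i + w) ∈ J
    rw [mul_add]
    exact add_mem hvi (hLJ hvw)
  have hUUJ : subMul U (subMul U J) ≤ J := subMul_le.2 fun a ha q hq => by
    suffices subMul U J ≤ J.comap (LinearMap.mulLeft K a) from this hq
    refine subMul_le.2 fun b hb => ?_
    suffices J ≤ J.comap (LinearMap.mulLeft K a ∘ₗ LinearMap.mulLeft K b) from this
    refine J_le ?_ fun l hl => by simp [hl.2 b hb]
    rintro x ⟨hx, hxU⟩
    obtain ⟨i, hi, w, hw, rfl⟩ := Submodule.mem_sup.1 hx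
    have hU := hP.mul_UV ha (hP.mul_UU hb hxU)
    change a * (b * (i + w)) ∈ J
    rw [mul_add, mul_add] at hU ⊢
    exact mem_J (hNI (Submodule.mem_sup_left ha) (hNI (Submodule.mem_sup_left hb) hi))
      (hP.mul_UU ha (hP.mul_UV hb hw)) hU
  have hIJV : I ≤ J ⊔ V := fun i hi => by
    obtain ⟨x, hx, v, hv, rfl⟩ := Submodule.mem_sup.1 (hIN hi)
    refine Submodule.add_mem_sup ?_ hv
    have := mem_J hi (neg_mem hv) (by rwa [add_neg_cancel_right])
    rwa [add_neg_cancel_right] at this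
  have hI_le {M : Submodule K A} (hM : I ≤ M) : I ≤ subMul U M ⊔ subMul V M := by
    rw [← subMul_sup_left]
    exact hI.ge.trans (subMul_mono le_rfl hM)
  have hIUJ : I ≤ J ⊔ subMul U J := fun i hi => by
    have h : I ≤ U ⊔ subMul U J := by
      refine (hI_le hIJV).trans ?_
      rw [subMul_sup_right (M := U), subMul_sup_right (M := V)]
      refine sup_le (sup_le le_sup_right (le_sup_of_le_left ?_))
        (le_sup_of_le_left (sup_le (hVJ.trans hJU) ?_))
      · exact subMul_le.2 fun a ha v hv => hP.mul_UV ha hv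
      · exact subMul_le.2 fun v hv w hw => hP.mul_VV hv hw
    obtain ⟨x, hx, v, hv, rfl⟩ := Submodule.mem_sup.1 (h hi)
    refine Submodule.add_mem_sup ?_ hv
    have := mem_J hi (neg_mem (hUJV hv)) (by rwa [add_neg_cancel_right])
    rwa [add_neg_cancel_right] at this
  have hJX : J ≤ subMul U (subMul U J) ⊔ (subMul V J ⊔ annU U) := by
    set X := subMul U (subMul U J) ⊔ (subMul V J ⊔ annU U)
    have hXU : X ≤ U := sup_le (hUUJ.trans hJU) (sup_le (hVJ.trans hJU) (annU_le U))
    have hIX : I ≤ X ⊔ V := by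
      refine (hI_le hIUJ).trans ?_
      rw [subMul_sup_right (M := U), subMul_sup_right (M := V)]
      refine sup_le (sup_le (le_sup_of_le_right hUJV) ?_) (le_sup_of_le_left (sup_le ?_ ?_))
      · exact le_sup_of_le_left le_sup_left
      · exact le_sup_of_le_right le_sup_left
      · exact (subMul_le.2 fun v hv w hw => hP.mul_VV_mem_annU hv (hUJV hw)).trans
          (le_sup_of_le_right le_sup_right)
    refine J_le ?_ (le_sup_of_le_right le_sup_right)
    calc (I ⊔ V) ⊓ U ≤ (X ⊔ V) ⊓ U := inf_le_inf_right _ (sup_le hIX le_sup_right)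
      _ = X := by rw [sup_inf_assoc_of_le _ hXU, hUV.symm.eq_bot, sup_bot_eq]
  have hJL : J ≤ annU U := hP.le_annU_of_le_subMul_V h2 hs hVs hJU hVJ
    (hP.le_subMul_V_of_le_sup hJU hUUJ h2 ht hUt hJX)
  have hUJ : subMul U J ≤ ⊥ := subMul_le.2 fun a ha x hx => (hJL hx).2 a ha
  exact hIUJ.trans (sup_le hJL (hUJ.trans bot_le))

theorem subMul_sup_eq_of_le_annU (hI : I ≤ annU U) : subMul (U ⊔ V) I = subMul V I := by
  have : subMul U I ≤ ⊥ := subMul_le.2 fun a ha x hx => (hI hx).2 a ha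
  rw [subMul_sup_left, le_bot_iff.1 this, bot_sup_eq]

end PeirceIdentities

/-- Let `A` be a Bernstein algebra over a field `K` of characteristic `≠ 2, 3`
which is Noetherian or Artinian, with Peirce decomposition `A = Ke ⊕ U ⊕ V` relative to an
idempotent `e` of weight `1`, and barideal `N = U ⊕ V`.  For a subspace `I` of `A` one has
`NI = I` if and only if `VI = I`. -/
theorem bernstein_chain_NI_eq_I_iff_VI_eq_I {K A : Type*} [Field K]
    [NonUnitalNonAssocCommRing A] [Module K A] [SMulCommClass K A A] [IsScalarTower K A A]
    (h2 : (2 : K) ≠ 0) (h3 : (3 : K) ≠ 0)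
    (ω : A →ₗ[K] K) (hωmul : ∀ x y : A, ω (x * y) = ω x * ω y) (hω0 : ω ≠ 0)
    (hbern : ∀ x : A, (x * x) * (x * x) = ω x ^ 2 • (x * x))
    (e : A) (he : e * e = e) (hωe : ω e = 1)
    -- `A` is Noetherian or Artinian
    (hchain :
      (∀ f : ℕ → Submodule K A, (∀ k, ∀ a : A, ∀ x ∈ f k, a * x ∈ f k) → Monotone f →
        ∃ n, ∀ m, n ≤ m → f m = f n) ∨
      (∀ f : ℕ → Submodule K A, (∀ k, ∀ a : A, ∀ x ∈ f k, a * x ∈ f k) → Antitone f →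
        ∃ n, ∀ m, n ≤ m → f m = f n))
    (I : Submodule K A) :
    -- `NI = I` iff `VI = I`, where `N = U ⊕ V` is the barideal
    subMul (peirceU K e ⊔ peirceV K e) I = I ↔ subMul (peirceV K e) I = I := by
  have hP := bernstein_peirceIdentities h2 hωmul hbern he hωe
  have hdec := exists_peirce_decomposition h2 h3 hbern he hωe
  have hdisj : Disjoint (peirceU K e) (peirceV K e) := disjoint_peirceU_peirceV h2
  have hch : ChainCondition (fun R : Submodule K A => ∀ a : A, ∀ x ∈ R, a * x ∈ R) := hchain
  have hUU : subMul (peirceU K e) (peirceU K e) ≤ peirceV K e :=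
    subMul_le.2 fun a ha b hb => hP.mul_UU ha hb
  have hUV : subMul (peirceU K e) (peirceV K e) ≤ peirceU K e :=
    subMul_le.2 fun a ha v hv => hP.mul_UV ha hv
  have hVU : subMul (peirceV K e) (peirceU K e) ≤ peirceU K e :=
    subMul_le.2 fun v hv a ha => hP.mul_VU hv ha
  have hVV : subMul (peirceV K e) (peirceV K e) ≤ peirceU K e :=
    subMul_le.2 fun v hv w hw => hP.mul_VV hv hw
  have hUV' : subMul (peirceU K e) (peirceV K e) ≤ subMul (peirceV K e) (peirceU K e) :=
    subMul_le.2 fun a ha v hv => mul_comm v a ▸ mul_mem_subMul hv ha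
  obtain ⟨s, hs, hVs⟩ := hch.exists_finset (C := peirceU K e) hUU hdisj
    fun R hPR hRQ => by
    rw [sup_comm]
    exact mul_mem_sup_of_peirce_decomposition hdec le_rfl hRQ hPR hVU
      ((subMul_mono le_rfl hRQ).trans hUV) ((subMul_mono le_rfl hRQ).trans hVV)
  obtain ⟨t, ht, hUt⟩ := hch.exists_finset (C := peirceV K e) (sup_le hVU hVV) hdisj.symm
    fun R hPR hRQ => mul_mem_sup_of_peirce_decomposition hdec hRQ le_rfl
      ((subMul_mono le_rfl hRQ).trans hUU) ((subMul_mono le_rfl hRQ).trans (le_sup_left.trans hPR))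
      (hUV'.trans (le_sup_left.trans hPR)) (le_sup_right.trans hPR)
  constructor
  · intro hI
    have hIN : I ≤ peirceU K e ⊔ peirceV K e := by
      rw [← hI]
      refine subMul_le.2 fun n hn i _ => ?_
      rw [mul_comm]
      exact mul_mem_sup_of_peirce_decomposition hdec le_rfl le_rfl hUU hVU hUV hVV i n hn
    rwa [PeirceIdentities.subMul_sup_eq_of_le_annU
      (hP.le_annU_of_subMul_sup_eq h2 hdisj hs hVs ht hUt hIN hI)] at hI
  · intro hI
    have hIU : I ≤ peirceU K e := by
      rw [← hI]
      refine subMul_le.2 fun v hv i _ => ?_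
      obtain ⟨c, u, hu, w, hw, rfl⟩ := hdec i
      rw [mul_add, mul_add, mul_smul_comm, mul_comm v e, mem_peirceV_iff.1 hv, smul_zero, zero_add]
      exact add_mem (hP.mul_VU hv hu) (hP.mul_VV hv hw)
    rwa [PeirceIdentities.subMul_sup_eq_of_le_annU
      (hP.le_annU_of_le_subMul_V h2 hs hVs hIU hI.le (hI.ge.trans le_sup_left))]
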